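/- For every positive integer n, the n-th Catalan number C_n = (1/(n+1))·C(2n, n) equals the determinant of the n×n matrix whose (i,j) entry is the binomial coefficient C(i, j − i + 1) for 1 ≤ i, j ≤ n. -/

import Mathlib

/-- The binomial coefficient with the convention `C(x, t) = 0` whenever
`t < 0` or `t > x`. -/
def hBinom (x t : ℤ) : ℤ := if 0 ≤ t ∧ t ≤ x then (x.toNat.choose t.toNat : ℤ) else 0

open Finset Nat in
theorem factorial_mul_catalan_mul_choose {k i : ℕ} (hi : i ≤ k + 1) :
    (k + 1)! * (catalan i * (i + 1).choose (k + 1 - i)) =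
      (k + 1).choose i * (2 * i).descFactorial k := by
  by_cases h : k ≤ 2 * i
  · have hcat : catalan i * (i ! * (i + 1)!) = (2 * i)! := by
      have h₁ := Nat.choose_mul_factorial_mul_factorial (show i ≤ 2 * i by omega)
      have h₂ := succ_mul_catalan_eq_centralBinom i
      rw [Nat.centralBinom_eq_two_mul_choose] at h₂
      rw [← h₂, show 2 * i - i = i by omega] at h₁
      rw [← h₁, Nat.factorial_succ]
      ring
    have hleft := Nat.choose_mul_factorial_mul_factorial (show k + 1 - i ≤ i + 1 by omega)
    rw [show i + 1 - (k + 1 - i) = 2 * i - k by omega] at hleft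
    have hright := Nat.choose_mul_factorial_mul_factorial hi
    have hdesc := Nat.factorial_mul_descFactorial h
    have hpos : 0 < i ! * (k + 1 - i)! * (2 * i - k)! := by positivity
    refine Nat.eq_of_mul_eq_mul_right hpos ?_
    calc
      _ = (k + 1)! * (catalan i * (i ! *
          ((i + 1).choose (k + 1 - i) * (k + 1 - i)! * (2 * i - k)!))) := by ring
      _ = ((k + 1).choose i * i ! * (k + 1 - i)!) *
          ((2 * i - k)! * (2 * i).descFactorial k) := by rw [hleft, hcat, hright, hdesc]
      _ = _ := by ring
  · rw [Nat.choose_eq_zero_of_lt (show i + 1 < k + 1 - i by omega),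
      Nat.descFactorial_of_lt (show 2 * i < k by omega)]
    simp

open Finset fwdDiff in
theorem sum_neg_one_pow_mul_choose_mul_eval_eq_zero {R : Type*} [CommRing R]
    {P : Polynomial R} {n : ℕ} (hP : P.natDegree < n) :
    ∑ i ∈ range (n + 1), (-1 : R) ^ i * (n.choose i * P.eval (i : R)) = 0 := by
  have h := congrFun (Polynomial.fwdDiff_iter_eq_zero_of_degree_lt hP) 0
  rw [fwdDiff_iter_eq_sum_shift] at h
  have h' := congrArg (fun x => (-1 : R) ^ n * x) h
  simp only [Pi.zero_apply, mul_zero, mul_sum] at h'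
  rw [← h']
  refine sum_congr rfl fun i hi => ?_
  obtain ⟨d, rfl⟩ := Nat.exists_eq_add_of_le (Nat.lt_succ_iff.mp (mem_range.mp hi))
  have hd : (-1 : R) ^ d * (-1) ^ d = 1 := by rw [← mul_pow]; simp
  simp only [zsmul_eq_mul, nsmul_eq_mul, mul_one, zero_add, add_tsub_cancel_left]
  push_cast
  linear_combination (-(-1 : R) ^ i * ((i + d).choose i * P.eval (i : R))) * hd

open Finset in
theorem sum_neg_one_pow_mul_catalan_mul_choose (k : ℕ) :
    ∑ i ∈ range (k + 2), (-1 : ℚ) ^ i * (catalan i * (i + 1).choose (k + 1 - i)) = 0 := by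
  set P : Polynomial ℚ := (descPochhammer ℚ k).comp (Polynomial.C 2 * Polynomial.X) with hP
  have hdeg : P.natDegree < k + 1 := by
    rw [hP, Polynomial.natDegree_comp, descPochhammer_natDegree,
      Polynomial.natDegree_C_mul_X _ two_ne_zero]
    omega
  have hfac : ((k + 1).factorial : ℚ) ≠ 0 := by positivity
  refine (mul_eq_zero_iff_left hfac).mp ?_
  rw [← sum_neg_one_pow_mul_choose_mul_eval_eq_zero hdeg, mul_sum]
  refine sum_congr rfl fun i hi => ?_
  have heval : P.eval (i : ℚ) = ((2 * i).descFactorial k : ℕ) := by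
    rw [← descPochhammer_eval_eq_descFactorial, hP]
    simp
  have h := congrArg (Nat.cast (R := ℚ))
    (factorial_mul_catalan_mul_choose (Nat.lt_succ_iff.mp (mem_range.mp hi)))
  push_cast at h
  rw [heval]
  linear_combination (-1 : ℚ) ^ i * h

theorem hBinom_of_le {i j : ℕ} (h : i ≤ j + 1) :
    hBinom ((i : ℤ) + 1) ((j : ℤ) - i + 1) = (i + 1).choose (j + 1 - i) := by
  have ht : ((j : ℤ) - i + 1).toNat = j + 1 - i := by omega
  have hx : ((i : ℤ) + 1).toNat = i + 1 := by omega
  unfold hBinom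
  split_ifs with hc
  · rw [ht, hx]
  · rw [Nat.choose_eq_zero_of_lt (by omega), Nat.cast_zero]

theorem hBinom_of_lt {i j : ℕ} (h : j + 1 < i) :
    hBinom ((i : ℤ) + 1) ((j : ℤ) - i + 1) = 0 :=
  if_neg (by omega)

open Finset in
theorem sum_neg_one_pow_mul_catalan_mul_hBinom {n j : ℕ} (h : j + 2 ≤ n) :
    ∑ i ∈ range n, (-1 : ℚ) ^ i * catalan i *
      (hBinom ((i : ℤ) + 1) ((j : ℤ) - i + 1) : ℚ) = 0 := by
  rw [← sum_neg_one_pow_mul_catalan_mul_choose j]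
  symm
  rw [← sum_subset (range_subset_range.mpr h) fun i _ hi => by
    rw [mem_range] at hi
    rw [hBinom_of_lt (by omega), Int.cast_zero, mul_zero]]
  refine sum_congr rfl fun i hi => ?_
  rw [mem_range] at hi
  rw [hBinom_of_le (by omega), Int.cast_natCast, mul_assoc]

/-- If a linear combination of the rows of an upper Hessenberg matrix with subdiagonal entries `1`
has coefficient `1` at the first row and equals `(0, …, 0, d)`, then the determinant of the matrix
is `(-1) ^ n * d`. -/
theorem Matrix.det_of_hessenberg {R : Type*} [CommRing R] {n : ℕ}
    (A : Matrix (Fin (n + 1)) (Fin (n + 1)) R) (c : Fin (n + 1) → R) (d : R) (hc : c 0 = 1)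
    (hsub : ∀ i : Fin n, A i.succ i.castSucc = 1)
    (hlow : ∀ i j : Fin n, j < i → A i.succ j.castSucc = 0)
    (hzero : ∀ j : Fin n, ∑ i, c i * A i j.castSucc = 0)
    (hlast : ∑ i, c i * A i (Fin.last n) = d) :
    A.det = (-1) ^ n * d := by
  have hdet := Matrix.det_updateRow_sum A 0 c
  rw [hc, one_smul] at hdet
  rw [← hdet, Matrix.det_succ_row_zero, Fin.sum_univ_castSucc]
  have hminor : (A.submatrix Fin.succ Fin.castSucc).det = 1 := by
    rw [Matrix.det_of_isUpperTriangular]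
    · simp [hsub]
    · exact fun i j hij => hlow i j hij
  have hsubm : (A.updateRow 0 (∑ k, c k • A k)).submatrix Fin.succ Fin.castSucc =
      A.submatrix Fin.succ Fin.castSucc := by
    ext i j
    simp
  simp [Finset.sum_apply, hzero, hlast, hsubm, hminor]

/-- The `n`-th Catalan number `C_n = (1 / (n + 1)) * C(2n, n)` equals the determinant
of the `n × n` matrix with `(i, j)` entry `C(i, j - i + 1)` (so, with the 0-based
index `i`, the entry is `C(i + 1, j - i + 1)`). -/
theorem catalan_eq_det (n : ℕ) (hn : 0 < n) :
    ((Nat.choose (2 * n) n : ℚ)) / ((n : ℚ) + 1) =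
      ((Matrix.of fun i j : Fin n =>
        ((hBinom ((i : ℕ) + 1) (((j : ℕ) : ℤ) - ((i : ℕ) : ℤ) + 1) : ℤ) : ℚ)).det) := by
  obtain ⟨n, rfl⟩ := Nat.exists_eq_add_one.mpr hn
  have hcat : ((2 * (n + 1)).choose (n + 1) : ℚ) / ((n + 1 : ℕ) + 1) = catalan (n + 1) := by
    rw [← Nat.centralBinom_eq_two_mul_choose, ← succ_mul_catalan_eq_centralBinom]
    push_cast
    field_simp
  rw [hcat, Matrix.det_of_hessenberg _ (fun i => (-1) ^ (i : ℕ) * (catalan i : ℚ))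
    ((-1) ^ n * catalan (n + 1))]
  · rw [← mul_assoc, ← mul_pow]
    simp
  · simp
  · intro i
    simpa using hBinom_of_le (le_refl ((i : ℕ) + 1))
  · intro i j hij
    have h : (j : ℕ) + 1 < (i : ℕ) + 1 := Nat.succ_lt_succ hij
    simpa using hBinom_of_lt h
  · intro j
    simpa [Finset.sum_range] using
      sum_neg_one_pow_mul_catalan_mul_hBinom (show (j : ℕ) + 2 ≤ n + 1 by omega)
  · have h := sum_neg_one_pow_mul_catalan_mul_hBinom (le_refl (n + 2))
    rw [Finset.sum_range_succ, hBinom_of_le le_rfl, Finset.sum_range] at h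
    simp only [Nat.sub_self, Nat.choose_zero_right, pow_succ] at h
    push_cast at h
    simp only [Matrix.of_apply, Fin.val_last]
    linear_combination h
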